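/- Consider an m-sensor system over ℝ with A ∈ ℝ^{n×n}, C ∈ ℝ^{m×n} with rows C_i, and for each i ∈ {1,…,m} let Q_i ⊆ {1,…,n} be nonempty, n_i := |Q_i|, H_i ∈ ℝ^{n_i×n} the selection matrix for Q_i, and Ã_i ∈ ℝ^{n_i×n_i}, C̃_i ∈ ℝ^{1×n_i}, L_i ∈ ℝ^{n_i×1} satisfying Ã_i H_i = H_i A and C̃_i H_i = C_i. Assume: (i) for each i, γ ≥ B_w + ‖L_i‖₂ B_v and σ_max(Ã_i − L_i C̃_i) ≤ (γ − B_w − ‖L_i‖₂ B_v)/((2√n_i + 1) γ), with γ > 0, B_w, B_v ≥ 0; (ii) for every j ∈ {1,…,n}, |{ i : j ∈ Q_i }| ≥ 2p + 1. Let x : ℕ → ℝ^n satisfy x(k+1) = A x(k) + w(k) with ‖w(k)‖₂ ≤ B_w, and let y_i(k) = C_i x(k) + v_i(k) + a_i(k) with |v_i(k)| ≤ B_v and |{ i : a_i(k) ≠ 0 }| ≤ p for every k. Define the algorithm: x̂(0) ∈ ℝ^n with ‖x̂(0) − x(0)‖_∞ ≤ γ and η_i⁺(0) := H_i x̂(0);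 for k ≥ 1, η_i(k) := (Ã_i − L_i C̃_i) η_i⁺(k−1) + L_i y_i(k−1); x̂(k) is any global minimizer over z ∈ ℝ^n of Σ_{i=1}^m ‖η_i(k) − H_i z‖₁; and η_i⁺(k) := H_i x̂(k) if ‖η_i(k) − H_i x̂(k)‖₂ > (√n_i + 1) γ, and η_i⁺(k) := η_i(k) otherwise. Then for every k ≥ 0, ‖x̂(k) − x(k)‖_∞ ≤ γ. -/

import Mathlib

open Matrix

/-- The 1-norm of a real vector. -/
def norm1 {n : ℕ} (x : Fin n → ℝ) : ℝ := ∑ j, |x j|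

/-- The Euclidean (2-)norm of a real vector. -/
noncomputable def vnorm2 {n : ℕ} (x : Fin n → ℝ) : ℝ := Real.sqrt (∑ j, (x j) ^ 2)

/-- The induced 2-norm (largest singular value) of a real matrix. -/
noncomputable def mat2Norm {p q : ℕ} (M : Matrix (Fin p) (Fin q) ℝ) : ℝ :=
  ‖LinearMap.toContinuousLinearMap (Matrix.toEuclideanLin M)‖

/-- The selection matrix of `Q ⊆ {1,…,n}`: its rows are the transposed canonical basis
vectors `e_jᵀ`, `j ∈ Q`, listed in increasing order of `j`. -/
def selMatrix {n d : ℕ} (Q : Finset (Fin n)) (h : Q.card = d) :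
    Matrix (Fin d) (Fin n) ℝ :=
  Matrix.of fun k j => if j = (Q.orderIsoOfFin h k : Fin n) then 1 else 0

theorem vnorm2_eq_norm {n : ℕ} (x : Fin n → ℝ) : vnorm2 x = ‖WithLp.toLp 2 x‖ := by
  simp [vnorm2, EuclideanSpace.norm_eq]

theorem vnorm2_nonneg {n : ℕ} (x : Fin n → ℝ) : 0 ≤ vnorm2 x := Real.sqrt_nonneg _

theorem vnorm2_add_le {n : ℕ} (x y : Fin n → ℝ) : vnorm2 (x + y) ≤ vnorm2 x + vnorm2 y := by
  simp only [vnorm2_eq_norm, WithLp.toLp_add]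
  exact norm_add_le _ _

theorem vnorm2_sub_le {n : ℕ} (x y : Fin n → ℝ) : vnorm2 (x - y) ≤ vnorm2 x + vnorm2 y := by
  simp only [vnorm2_eq_norm, WithLp.toLp_sub]
  exact norm_sub_le _ _

theorem vnorm2_smul {n : ℕ} (c : ℝ) (x : Fin n → ℝ) : vnorm2 (c • x) = |c| * vnorm2 x := by
  simp only [vnorm2_eq_norm, WithLp.toLp_smul, norm_smul, Real.norm_eq_abs]

theorem abs_apply_le_vnorm2 {n : ℕ} (x : Fin n → ℝ) (j : Fin n) : |x j| ≤ vnorm2 x := by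
  rw [vnorm2_eq_norm]
  exact PiLp.norm_apply_le (WithLp.toLp 2 x) j

theorem vnorm2_le_sqrt_card_mul {d : ℕ} (x : Fin d → ℝ) {γ : ℝ} (hγ : 0 ≤ γ)
    (h : ∀ k, |x k| ≤ γ) : vnorm2 x ≤ √d * γ := by
  rw [vnorm2, ← Real.sqrt_sq hγ, ← Real.sqrt_mul (Nat.cast_nonneg d)]
  refine Real.sqrt_le_sqrt ?_
  calc ∑ j, x j ^ 2 ≤ ∑ _j : Fin d, γ ^ 2 :=
        Finset.sum_le_sum fun j _ => sq_le_sq.2 ((h j).trans (le_abs_self γ))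
    _ = d * γ ^ 2 := by simp

theorem vnorm2_mulVec_le {p q : ℕ} (M : Matrix (Fin p) (Fin q) ℝ) (x : Fin q → ℝ) :
    vnorm2 (M *ᵥ x) ≤ mat2Norm M * vnorm2 x := by
  rw [vnorm2_eq_norm, vnorm2_eq_norm]
  exact (LinearMap.toContinuousLinearMap (Matrix.toEuclideanLin M)).le_opNorm (WithLp.toLp 2 x)

theorem selMatrix_mulVec_apply {n d : ℕ} (Q : Finset (Fin n)) (h : Q.card = d)
    (z : Fin n → ℝ) (k : Fin d) :
    (selMatrix Q h *ᵥ z) k = z (Q.orderIsoOfFin h k : Fin n) := by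
  simp only [selMatrix, Matrix.mulVec, dotProduct, Matrix.of_apply, ite_mul, one_mul, zero_mul,
    Finset.sum_ite_eq', Finset.mem_univ, if_true]

theorem vnorm2_selMatrix_mulVec_le {n d : ℕ} (Q : Finset (Fin n)) (h : Q.card = d)
    (z : Fin n → ℝ) : vnorm2 (selMatrix Q h *ᵥ z) ≤ vnorm2 z := by
  refine Real.sqrt_le_sqrt ?_
  simp only [selMatrix_mulVec_apply]
  rw [(Q.orderIsoOfFin h).bijective.sum_comp (fun j : Q => z j ^ 2),
    Finset.sum_coe_sort Q fun j => z j ^ 2]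
  exact Finset.sum_le_sum_of_subset_of_nonneg (Finset.subset_univ Q) fun _ _ _ => sq_nonneg _

theorem vnorm2_selMatrix_mulVec_le_of_abs_le {n d : ℕ} (Q : Finset (Fin n)) (h : Q.card = d)
    (z : Fin n → ℝ) {γ : ℝ} (hγ : 0 ≤ γ) (hz : ∀ j, |z j| ≤ γ) :
    vnorm2 (selMatrix Q h *ᵥ z) ≤ √d * γ :=
  vnorm2_le_sqrt_card_mul _ hγ fun k => by simpa only [selMatrix_mulVec_apply] using hz _

theorem norm1_sub_selMatrix_update_of_notMem {n d : ℕ} (Q : Finset (Fin n)) (h : Q.card = d)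
    (b : Fin d → ℝ) (z : Fin n → ℝ) {j : Fin n} (t : ℝ) (hj : j ∉ Q) :
    norm1 (b - selMatrix Q h *ᵥ Function.update z j t) = norm1 (b - selMatrix Q h *ᵥ z) := by
  refine Finset.sum_congr rfl fun k _ => ?_
  have hne : (Q.orderIsoOfFin h k : Fin n) ≠ j := fun e => hj (e ▸ (Q.orderIsoOfFin h k).2)
  simp only [Pi.sub_apply, selMatrix_mulVec_apply, Function.update_of_ne hne]

theorem norm1_sub_selMatrix_update {n d : ℕ} (Q : Finset (Fin n)) (h : Q.card = d)
    (b : Fin d → ℝ) (z : Fin n → ℝ) (t : ℝ) (k : Fin d) :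
    norm1 (b - selMatrix Q h *ᵥ Function.update z (Q.orderIsoOfFin h k) t) =
      norm1 (b - selMatrix Q h *ᵥ z) +
        (|b k - t| - |b k - z (Q.orderIsoOfFin h k)|) := by
  rw [← sub_eq_iff_eq_add', norm1, norm1, ← Finset.sum_sub_distrib,
    Finset.sum_eq_single_of_mem k (Finset.mem_univ k)]
  · simp only [Pi.sub_apply, selMatrix_mulVec_apply, Function.update_self]
  · intro l _ hl
    have hne : (Q.orderIsoOfFin h l : Fin n) ≠ Q.orderIsoOfFin h k := fun e =>
      hl ((Q.orderIsoOfFin h).injective (Subtype.ext e))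
    simp only [Pi.sub_apply, selMatrix_mulVec_apply, Function.update_of_ne hne, sub_self]

/-- If `z` minimizes the `ℓ¹` fusion cost, and all local estimates of coordinate `j` outside a
minority `S` lie on the side of `t` opposite to `z j`, then `z j = t`. -/
theorem eq_of_minimizes_norm1_fusion {n m p : ℕ} (Q : Fin m → Finset (Fin n))
    (b : ∀ i, Fin (Q i).card → ℝ) (z : Fin n → ℝ)
    (hmin : ∀ z', ∑ i, norm1 (b i - selMatrix (Q i) rfl *ᵥ z) ≤
      ∑ i, norm1 (b i - selMatrix (Q i) rfl *ᵥ z'))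
    (S : Finset (Fin m)) (hS : S.card ≤ p) (j : Fin n)
    (hcover : 2 * p + 1 ≤ (Finset.univ.filter fun i => j ∈ Q i).card) (t : ℝ)
    (hgood : ∀ i ∉ S, ∀ k, ((Q i).orderIsoOfFin rfl k : Fin n) = j →
      |b i k - t| ≤ |b i k - z j| - |z j - t|) : z j = t := by
  set T := Finset.univ.filter fun i => j ∈ Q i
  set δ := |z j - t|
  have key : ∀ i, norm1 (b i - selMatrix (Q i) rfl *ᵥ Function.update z j t) ≤
      norm1 (b i - selMatrix (Q i) rfl *ᵥ z) +
        ((if i ∈ S then 2 * δ else 0) - (if i ∈ T then δ else 0)) := by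
    intro i
    have hδ : 0 ≤ δ := abs_nonneg _
    by_cases hj : j ∈ Q i
    · obtain ⟨k, hk⟩ := ((Q i).orderIsoOfFin rfl).surjective ⟨j, hj⟩
      have hk' : ((Q i).orderIsoOfFin rfl k : Fin n) = j := by rw [hk]
      have hupd := norm1_sub_selMatrix_update (Q i) rfl (b i) z t k
      rw [hk'] at hupd
      have hT : i ∈ T := by simp [T, hj]
      rw [hupd, if_pos hT]
      by_cases hi : i ∈ S
      · rw [if_pos hi]
        have := abs_sub_le (b i k) (z j) t
        linarith
      · rw [if_neg hi]
        linarith [hgood i hi k hk']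
    · have hT : i ∉ T := by simp [T, hj]
      rw [norm1_sub_selMatrix_update_of_notMem _ _ _ _ _ hj, if_neg hT]
      split_ifs <;> linarith
  have hsum := (hmin (Function.update z j t)).trans (Finset.sum_le_sum fun i _ => key i)
  rw [Finset.sum_add_distrib, Finset.sum_sub_distrib, Finset.sum_ite_mem, Finset.sum_ite_mem,
    Finset.univ_inter, Finset.univ_inter, Finset.sum_const, Finset.sum_const, nsmul_eq_mul,
    nsmul_eq_mul] at hsum
  have hS' : (S.card : ℝ) ≤ p := by exact_mod_cast hS
  have hT' : 2 * (p : ℝ) + 1 ≤ T.card := by exact_mod_cast hcover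
  have hδ : 0 ≤ δ := abs_nonneg _
  have hδ0 : δ ≤ 0 := by nlinarith
  exact sub_eq_zero.1 (abs_nonpos_iff.1 hδ0)

theorem abs_sub_le_of_minimizes_norm1_fusion {n m p : ℕ} (Q : Fin m → Finset (Fin n))
    (b : ∀ i, Fin (Q i).card → ℝ) (z x : Fin n → ℝ) {γ : ℝ}
    (hmin : ∀ z', ∑ i, norm1 (b i - selMatrix (Q i) rfl *ᵥ z) ≤
      ∑ i, norm1 (b i - selMatrix (Q i) rfl *ᵥ z'))
    (S : Finset (Fin m)) (hS : S.card ≤ p)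
    (hcover : ∀ j, 2 * p + 1 ≤ (Finset.univ.filter fun i => j ∈ Q i).card)
    (hgood : ∀ i ∉ S, vnorm2 (b i - selMatrix (Q i) rfl *ᵥ x) ≤ γ) (j : Fin n) :
    |z j - x j| ≤ γ := by
  have hclose : ∀ i ∉ S, ∀ k, ((Q i).orderIsoOfFin rfl k : Fin n) = j →
      |b i k - x j| ≤ γ := by
    intro i hi k hk
    have h := (abs_apply_le_vnorm2 _ k).trans (hgood i hi)
    rwa [Pi.sub_apply, selMatrix_mulVec_apply, hk] at h
  rw [abs_le]
  constructor
  · by_contra! hlt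
    have := eq_of_minimizes_norm1_fusion Q b z hmin S hS j (hcover j) (x j - γ) fun i hi k hk => by
      obtain ⟨h1, -⟩ := abs_le.1 (hclose i hi k hk)
      rw [abs_of_nonneg (by linarith), abs_of_nonneg (by linarith), abs_of_neg (by linarith)]
      linarith
    linarith
  · by_contra! hlt
    have := eq_of_minimizes_norm1_fusion Q b z hmin S hS j (hcover j) (x j + γ) fun i hi k hk => by
      obtain ⟨-, h2⟩ := abs_le.1 (hclose i hi k hk)
      rw [abs_of_nonpos (by linarith), abs_of_neg (by linarith), abs_of_pos (by linarith)]
      linarith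
    linarith

/-- Error dynamics of a local observer. -/
theorem local_observer_error {n d : ℕ} (A : Matrix (Fin n) (Fin n) ℝ) (c : Fin n → ℝ)
    (H : Matrix (Fin d) (Fin n) ℝ) (At : Matrix (Fin d) (Fin d) ℝ) (ct L : Fin d → ℝ)
    (hA : At * H = H * A) (hc : ct ᵥ* H = c) (x w : Fin n → ℝ) (e : Fin d → ℝ) (v : ℝ) :
    (At - vecMulVec L ct) *ᵥ e + (c ⬝ᵥ x + v) • L - H *ᵥ (A *ᵥ x + w) =
      (At - vecMulVec L ct) *ᵥ (e - H *ᵥ x) + v • L - H *ᵥ w := by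
  have h1 : H *ᵥ (A *ᵥ x) = At *ᵥ (H *ᵥ x) := by
    rw [mulVec_mulVec, mulVec_mulVec, hA]
  have h2 : vecMulVec L ct *ᵥ (H *ᵥ x) = (c ⬝ᵥ x) • L := by
    rw [vecMulVec_mulVec, dotProduct_mulVec, hc, op_smul_eq_smul]
  rw [mulVec_add, h1, mulVec_sub, sub_mulVec At _ (H *ᵥ x), h2, add_smul]
  abel

/-- Theorem 6, main secure-estimation result: under the structural
identities `Ã_i H_i = H_i A`, `C̃_i H_i = C_i`, the gain/threshold design inequalities,
the coverage condition `|{i : j ∈ Q_i}| ≥ 2p + 1`, bounded noises, `p`-sparse (possibly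
time-varying) attacks, and the estimation algorithm (local observers, `ℓ¹`-fusion
minimizer, detection-and-reset), the estimate satisfies `‖x̂(k) − x(k)‖_∞ ≤ γ` for all
`k ≥ 0`. -/
theorem stmt15 {n m p : ℕ}
    (A : Matrix (Fin n) (Fin n) ℝ) (C : Matrix (Fin m) (Fin n) ℝ)
    (Q : Fin m → Finset (Fin n)) (hQne : ∀ i, (Q i).Nonempty)
    (Atil : ∀ i, Matrix (Fin (Q i).card) (Fin (Q i).card) ℝ)
    (ctil : ∀ i, Fin (Q i).card → ℝ)
    (L : ∀ i, Fin (Q i).card → ℝ)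
    (hAH : ∀ i, Atil i * selMatrix (Q i) rfl = selMatrix (Q i) rfl * A)
    (hCH : ∀ i, Matrix.vecMul (ctil i) (selMatrix (Q i) rfl) = C i)
    (γ Bw Bv : ℝ) (hγ : 0 < γ) (hBw : 0 ≤ Bw) (hBv : 0 ≤ Bv)
    (hgain1 : ∀ i, Bw + vnorm2 (L i) * Bv ≤ γ)
    (hgain2 : ∀ i, mat2Norm (Atil i - Matrix.vecMulVec (L i) (ctil i))
        ≤ (γ - Bw - vnorm2 (L i) * Bv) / ((2 * Real.sqrt (Q i).card + 1) * γ))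
    (hcover : ∀ j : Fin n, 2 * p + 1 ≤ (Finset.univ.filter fun i => j ∈ Q i).card)
    (x w : ℕ → Fin n → ℝ)
    (hx : ∀ k, x (k + 1) = A.mulVec (x k) + w k)
    (hw : ∀ k, vnorm2 (w k) ≤ Bw)
    (v a y : ℕ → Fin m → ℝ)
    (hv : ∀ k i, |v k i| ≤ Bv)
    (ha : ∀ k, (Finset.univ.filter fun i => a k i ≠ 0).card ≤ p)
    (hy : ∀ k i, y k i = C i ⬝ᵥ x k + v k i + a k i)
    (xhat : ℕ → Fin n → ℝ)
    (hxhat0 : ∀ j, |xhat 0 j - x 0 j| ≤ γ)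
    (η ηp : ∀ i : Fin m, ℕ → Fin (Q i).card → ℝ)
    (hηp0 : ∀ i, ηp i 0 = (selMatrix (Q i) rfl).mulVec (xhat 0))
    (hη : ∀ i k, η i (k + 1)
      = (Atil i - Matrix.vecMulVec (L i) (ctil i)).mulVec (ηp i k) + y k i • L i)
    (hmin : ∀ k, 1 ≤ k → ∀ z : Fin n → ℝ,
      ∑ i, norm1 (η i k - (selMatrix (Q i) rfl).mulVec (xhat k))
        ≤ ∑ i, norm1 (η i k - (selMatrix (Q i) rfl).mulVec z))
    (hreset : ∀ i k, 1 ≤ k →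
      ηp i k = if (Real.sqrt (Q i).card + 1) * γ
          < vnorm2 (η i k - (selMatrix (Q i) rfl).mulVec (xhat k))
        then (selMatrix (Q i) rfl).mulVec (xhat k) else η i k) :
    ∀ k j, |xhat k j - x k j| ≤ γ := by
  have hinv : ∀ k, (∀ j, |xhat k j - x k j| ≤ γ) ∧
      ∀ i, vnorm2 (ηp i k - selMatrix (Q i) rfl *ᵥ x k) ≤ (2 * √(Q i).card + 1) * γ := by
    have hH : ∀ k, (∀ j, |xhat k j - x k j| ≤ γ) → ∀ i,
        vnorm2 (selMatrix (Q i) rfl *ᵥ xhat k - selMatrix (Q i) rfl *ᵥ x k) ≤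
          √(Q i).card * γ := by
      intro k hk i
      rw [← mulVec_sub]
      exact vnorm2_selMatrix_mulVec_le_of_abs_le _ _ _ hγ.le hk
    have hpos : ∀ i, 0 ≤ √((Q i).card : ℝ) * γ := fun i =>
      mul_nonneg (Real.sqrt_nonneg _) hγ.le
    intro k
    induction k with
    | zero =>
      refine ⟨hxhat0, fun i => ?_⟩
      rw [hηp0]
      linarith [hH 0 hxhat0 i, hpos i]
    | succ k ih =>
      have hlocal : ∀ i ∉ Finset.univ.filter (fun i => a k i ≠ 0),
          vnorm2 (η i (k + 1) - selMatrix (Q i) rfl *ᵥ x (k + 1)) ≤ γ := by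
        intro i hi
        have ha0 : a k i = 0 := by simpa using hi
        rw [hη, hy, ha0, add_zero, hx,
          local_observer_error A (C i) _ (Atil i) (ctil i) (L i) (hAH i) (hCH i)]
        have hden : 0 < (2 * √((Q i).card : ℝ) + 1) * γ := by positivity
        have h1 := (vnorm2_mulVec_le (Atil i - vecMulVec (L i) (ctil i))
          (ηp i k - selMatrix (Q i) rfl *ᵥ x k)).trans
            (mul_le_mul_of_nonneg_left (ih.2 i) (norm_nonneg _))
        have h2 := (le_div_iff₀ hden).1 (hgain2 i)
        have h3 : vnorm2 (v k i • L i) ≤ Bv * vnorm2 (L i) := by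
          rw [vnorm2_smul]
          exact mul_le_mul_of_nonneg_right (hv k i) (vnorm2_nonneg _)
        have h4 := (vnorm2_selMatrix_mulVec_le (Q i) rfl (w k)).trans (hw k)
        refine (vnorm2_sub_le _ _).trans ((add_le_add_left (vnorm2_add_le _ _) _).trans ?_)
        linarith
      have hest := abs_sub_le_of_minimizes_norm1_fusion Q (fun i => η i (k + 1)) (xhat (k + 1))
        (x (k + 1)) (hmin (k + 1) (Nat.le_add_left 1 k)) _ (ha k) hcover hlocal
      refine ⟨hest, fun i => ?_⟩
      rw [hreset i (k + 1) (Nat.le_add_left 1 k)]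
      split_ifs with hc
      · linarith [hH (k + 1) hest i, hpos i]
      · have hsplit := vnorm2_add_le
          (η i (k + 1) - selMatrix (Q i) rfl *ᵥ xhat (k + 1))
          (selMatrix (Q i) rfl *ᵥ xhat (k + 1) - selMatrix (Q i) rfl *ᵥ x (k + 1))
        rw [sub_add_sub_cancel] at hsplit
        linarith [hH (k + 1) hest i, not_lt.1 hc]
  exact fun k => (hinv k).1
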